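/- Let d > 2 and let α ∈ ℝ^d satisfy α_i ≥ α_{i+1} for all 1 ≤ i ≤ d−1 and Σ_{i=1}^d α_i = 0. Let m be an integer with 1 ≤ m ≤ d−1 and α_m ≥ 0 ≥ α_{m+1}. Then for k = 1 and for k = d−1, and for every permutation w of {1,…,d}: h_k(w) − Φ_k(w) ≤ h_G − Σ_{i=1}^d α_i⁺. -/

import Mathlib

/-- `h_k(w)`: the entropy of `diag(α_{w 1},…,α_{w d})` on the standard maximal
parabolic subgroup `P_k` of `SL_d(ℝ)`. -/
noncomputable def entk (d k : ℕ) (α : ℕ → ℝ) (w : ℕ → ℕ) : ℝ :=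
    (∑ i ∈ Finset.Icc 1 k, ∑ j ∈ Finset.Icc 1 k, max (α (w i) - α (w j)) 0)
  + (∑ i ∈ Finset.Icc (k + 1) d, ∑ j ∈ Finset.Icc (k + 1) d, max (α (w i) - α (w j)) 0)
  + (∑ i ∈ Finset.Icc 1 k, ∑ j ∈ Finset.Icc (k + 1) d, max (α (w i) - α (w j)) 0)

/-- `h_G = Σ_{1≤i,j≤d} (α_i − α_j)⁺`. -/
noncomputable def entG (d : ℕ) (α : ℕ → ℝ) : ℝ :=
  ∑ i ∈ Finset.Icc 1 d, ∑ j ∈ Finset.Icc 1 d, max (α i - α j) 0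

/-- `Φ_k(w) = z_1·(1/k)Σ_{i=1}^k α_{w i} + z_d·(1/(d−k))Σ_{i=k+1}^d α_{w i}`,
the value of `φ_all = z_1λ_1 + z_dλ_d` on the projection of `diag(α∘w)` to
`Lie(A_{P_k})`, where `z_1 = (d−1)(m−1)/(d−2)`, `z_d = −(d−1)(d−m−1)/(d−2)`. -/
noncomputable def Phik (d k m : ℕ) (α : ℕ → ℝ) (w : ℕ → ℕ) : ℝ :=
    (((d : ℝ) - 1) * ((m : ℝ) - 1) / ((d : ℝ) - 2))
      * ((1 / (k : ℝ)) * ∑ i ∈ Finset.Icc 1 k, α (w i))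
  + (-(((d : ℝ) - 1) * ((d : ℝ) - (m : ℝ) - 1) / ((d : ℝ) - 2)))
      * ((1 / ((d : ℝ) - (k : ℝ))) * ∑ i ∈ Finset.Icc (k + 1) d, α (w i))

theorem aux_split (d k : ℕ) (hk : k ≤ d) (f : ℕ → ℝ) :
    ∑ i ∈ Finset.Icc 1 d, f i
      = ∑ i ∈ Finset.Icc 1 k, f i + ∑ i ∈ Finset.Icc (k + 1) d, f i := by
  rw [← Finset.sum_union]
  · congr 1
    ext x
    simp only [Finset.mem_Icc, Finset.mem_union]
    omega
  · rw [Finset.disjoint_left]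
    intro x
    simp only [Finset.mem_Icc]
    omega

theorem aux_perm (d : ℕ) (w : Equiv.Perm ℕ)
    (hw : ∀ i ∈ Finset.Icc 1 d, w i ∈ Finset.Icc 1 d) (f : ℕ → ℝ) :
    ∑ i ∈ Finset.Icc 1 d, f (w i) = ∑ i ∈ Finset.Icc 1 d, f i := by
  have h : (Finset.Icc 1 d).map w.toEmbedding = Finset.Icc 1 d := by
    apply Finset.eq_of_subset_of_card_le
    · intro x hx
      obtain ⟨y, hy, rfl⟩ := Finset.mem_map.1 hx
      exact hw y hy
    · simp
  conv_rhs => rw [← h, Finset.sum_map]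
  rfl

theorem aux_ent (d k : ℕ) (hk : k ≤ d) (α : ℕ → ℝ) (w : Equiv.Perm ℕ)
    (hw : ∀ i ∈ Finset.Icc 1 d, w i ∈ Finset.Icc 1 d) :
    entG d α = entk d k α w
      + ∑ i ∈ Finset.Icc (k + 1) d, ∑ j ∈ Finset.Icc 1 k, max (α (w i) - α (w j)) 0 := by
  have h1 : entG d α
      = ∑ i ∈ Finset.Icc 1 d, ∑ j ∈ Finset.Icc 1 d, max (α (w i) - α (w j)) 0 := by
    unfold entG
    rw [← aux_perm d w hw]
    refine Finset.sum_congr rfl fun i _ => ?_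
    rw [← aux_perm d w hw]
  rw [h1]
  simp only [aux_split d k hk, Finset.sum_add_distrib]
  unfold entk
  ring

theorem aux_ite (d m : ℕ) (hmd : m ≤ d) (a : ℝ) :
    ∑ i ∈ Finset.Icc 1 d, (if i ≤ m then a else 0) = m * a := by
  rw [aux_split d m hmd]
  have h1 : ∑ i ∈ Finset.Icc 1 m, (if i ≤ m then a else 0) = ∑ i ∈ Finset.Icc 1 m, a :=
    Finset.sum_congr rfl fun i hi => if_pos (Finset.mem_Icc.1 hi).2
  have h2 : ∑ i ∈ Finset.Icc (m + 1) d, (if i ≤ m then a else 0) = 0 :=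
    Finset.sum_eq_zero fun i hi => if_neg (by have := (Finset.mem_Icc.1 hi).1; omega)
  rw [h1, h2]
  simp

/-- For `k = 1` and `k = d−1` and every permutation `w`:
`h_k(w) − Φ_k(w) ≤ h_G − Σ_{i=1}^d α_i⁺`. -/
theorem stmt_10 (d m : ℕ) (hd : 2 < d)
    (α : ℕ → ℝ) (hmono : ∀ i ∈ Finset.Icc 1 (d - 1), α (i + 1) ≤ α i)
    (hsum : ∑ i ∈ Finset.Icc 1 d, α i = 0)
    (hm1 : 1 ≤ m) (hmd : m ≤ d - 1) (hsgn1 : 0 ≤ α m) (hsgn2 : α (m + 1) ≤ 0) :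
    ∀ k : ℕ, (k = 1 ∨ k = d - 1) →
      ∀ w : Equiv.Perm ℕ, (∀ i ∈ Finset.Icc 1 d, w i ∈ Finset.Icc 1 d) →
        entk d k α ⇑w - Phik d k m α ⇑w
          ≤ entG d α - ∑ i ∈ Finset.Icc 1 d, max (α i) 0 := by
  have hanti : ∀ j, j ≤ d → ∀ i, 1 ≤ i → i ≤ j → α j ≤ α i := by
    intro j
    induction j with
    | zero => intro _ i h1 h2; omega
    | succ n ih =>
      intro hn i h1 h2
      rcases Nat.lt_or_ge n i with h | h
      · have : i = n + 1 := by omega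
        rw [this]
      · exact (hmono n (Finset.mem_Icc.2 ⟨by omega, by omega⟩)).trans (ih (by omega) i h1 h)
  have hpos : ∀ i, 1 ≤ i → i ≤ m → 0 ≤ α i := fun i h1 h2 =>
    hsgn1.trans (hanti m (by omega) i h1 h2)
  have hneg : ∀ i, m < i → i ≤ d → α i ≤ 0 := fun i h1 h2 =>
    (hanti i h2 (m + 1) (by omega) (by omega)).trans hsgn2
  have hd2 : (d : ℝ) - 2 ≠ 0 := by
    have : (2 : ℝ) < d := by exact_mod_cast hd
    linarith
  have hd1 : (d : ℝ) - 1 ≠ 0 := by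
    have : (2 : ℝ) < d := by exact_mod_cast hd
    linarith
  rintro k (rfl | rfl) w hw
  · have hE := aux_ent d 1 (by omega) α w hw
    have hS := aux_split d 1 (by omega) (fun i => α (w i))
    have hT := aux_split d 1 (by omega) (fun i => max (α (w i) - α (w 1)) 0)
    rw [aux_perm d w hw α, hsum] at hS
    rw [aux_perm d w hw (fun x => max (α x - α (w 1)) 0)] at hT
    simp only [Finset.Icc_self, Finset.sum_singleton, sub_self, max_self, zero_add] at hE hS hT
    have hP : Phik d 1 m α w = m * α (w 1) := by
      unfold Phik
      have : ∑ i ∈ Finset.Icc (1 + 1) d, α (w i) = - α (w 1) := by linarith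
      rw [this]
      simp only [Finset.Icc_self, Finset.sum_singleton, Nat.cast_one]
      field_simp
      ring
    have hB : ∑ i ∈ Finset.Icc 1 d, max (α i) 0
        ≤ ∑ i ∈ Finset.Icc 1 d, (max (α i - α (w 1)) 0 + if i ≤ m then α (w 1) else 0) := by
      refine Finset.sum_le_sum fun i hi => ?_
      rw [Finset.mem_Icc] at hi
      split_ifs with h
      · rw [max_eq_left (hpos i hi.1 h)]
        linarith [le_max_left (α i - α (w 1)) 0]
      · rw [max_eq_right (hneg i (by omega) hi.2)]
        linarith [le_max_right (α i - α (w 1)) 0]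
    rw [Finset.sum_add_distrib, aux_ite d m (by omega)] at hB
    rw [hP]
    linarith
  · obtain ⟨n, rfl⟩ : ∃ n, d = n + 1 := ⟨d - 1, by omega⟩
    simp only [Nat.add_sub_cancel] at *
    have hE := aux_ent (n + 1) n (by omega) α w hw
    have hS := aux_split (n + 1) n (by omega) (fun i => α (w i))
    have hT := aux_split (n + 1) n (by omega) (fun i => max (α (w (n + 1)) - α (w i)) 0)
    rw [aux_perm (n + 1) w hw α, hsum] at hS
    rw [aux_perm (n + 1) w hw (fun x => max (α (w (n + 1)) - α x) 0)] at hT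
    simp only [Finset.Icc_self, Finset.sum_singleton, sub_self, max_self, add_zero] at hE hS hT
    have hP : Phik (n + 1) n m α w = (m - (n + 1)) * α (w (n + 1)) := by
      unfold Phik
      have : ∑ i ∈ Finset.Icc 1 n, α (w i) = - α (w (n + 1)) := by linarith
      rw [this]
      simp only [Finset.Icc_self, Finset.sum_singleton]
      push_cast at hd1 hd2 ⊢
      have hn : (n : ℝ) ≠ 0 := by intro h; apply hd1; rw [h]; ring
      have hn1 : (n : ℝ) - 1 ≠ 0 := by intro h; apply hd2; linarith
      have e1 : (n : ℝ) + 1 - n = 1 := by ring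
      have e2 : (n : ℝ) + 1 - 2 = n - 1 := by ring
      have e3 : (n : ℝ) + 1 - 1 = n := by ring
      rw [e1, e2, e3]
      field_simp
      ring
    have hB : ∑ i ∈ Finset.Icc 1 (n + 1), max (α i) 0
        ≤ ∑ i ∈ Finset.Icc 1 (n + 1), (α i + max (α (w (n + 1)) - α i) 0
            + (if i ≤ m then α (w (n + 1)) else 0) - α (w (n + 1))) := by
      refine Finset.sum_le_sum fun i hi => ?_
      rw [Finset.mem_Icc] at hi
      split_ifs with h
      · rw [max_eq_left (hpos i hi.1 h)]
        linarith [le_max_right (α (w (n + 1)) - α i) 0]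
      · rw [max_eq_right (hneg i (by omega) hi.2)]
        linarith [le_max_left (α (w (n + 1)) - α i) 0]
    rw [Finset.sum_sub_distrib, Finset.sum_add_distrib, Finset.sum_add_distrib,
      aux_ite (n + 1) m (by omega), hsum] at hB
    simp only [Finset.sum_const, Nat.card_Icc, Nat.add_sub_cancel, nsmul_eq_mul] at hB
    push_cast at hB
    rw [hP]
    linarith
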